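/- (Truth Lemma) Let Δ0 be an MCS containing K_x y = T_y, K_y x = T_x, x ≡ c_x, y ≡ c_y, and let M^{Δ0} be the induced canonical model. For every formula φ ∈ L^- and every Δ ∈ Σ of M^{Δ0}: M^{Δ0}, Δ ⊨ φ if and only if φ ∈ Δ. -/

import Mathlib

/-! Core definitions for the Epistemic Logic of Cops and Robbers (ELCR). -/

/-- The two players/variables. -/
inductive Var : Type
  | x | y
  deriving DecidableEq

/-- The other variable. -/
def Var.other : Var → Var
  | .x => .y
  | .y => .x

/-- Terms: constants or variables. -/
inductive Term (Cons : Type) : Type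
  | const (c : Cons)
  | var (v : Var)
  deriving DecidableEq

/-- Formulas of the full language `L` (with movement modalities). -/
inductive Form (Pred Cons : Type) : Type
  | pred (P : Pred) (args : List (Term Cons))
  | rel (t₁ t₂ : Term Cons)
  | eq (t₁ t₂ : Term Cons)
  | neg (φ : Form Pred Cons)
  | and (φ ψ : Form Pred Cons)
  | Kt (z : Var) (t : Term Cons)
  | K (z : Var) (φ : Form Pred Cons)
  | box (z : Var) (φ : Form Pred Cons)

namespace Form

variable {Pred Cons : Type}

def imp (φ ψ : Form Pred Cons) : Form Pred Cons := .neg (.and φ (.neg ψ))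
def or (φ ψ : Form Pred Cons) : Form Pred Cons := .neg (.and (.neg φ) (.neg ψ))
def iffF (φ ψ : Form Pred Cons) : Form Pred Cons := .and (imp φ ψ) (imp ψ φ)
def falseF : Form Pred Cons := .neg (.eq (.var .x) (.var .x))
def trueF : Form Pred Cons := .neg falseF
/-- `⟨K_z⟩φ := ¬K_z¬φ`. -/
def diaK (z : Var) (φ : Form Pred Cons) : Form Pred Cons := .neg (.K z (.neg φ))

def bigAnd : List (Form Pred Cons) → Form Pred Cons
  | [] => trueF
  | φ :: l => .and φ (bigAnd l)

def bigOr : List (Form Pred Cons) → Form Pred Cons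
  | [] => falseF
  | φ :: l => or φ (bigOr l)

/-- Membership in the Boolean base language `L_B`. -/
def isBase : Form Pred Cons → Prop
  | .pred _ _ => True
  | .rel _ _ => True
  | .eq _ _ => True
  | .neg φ => isBase φ
  | .and φ ψ => isBase φ ∧ isBase ψ
  | .Kt _ _ => False
  | .K _ _ => False
  | .box _ _ => False

/-- Membership in `L_BD` (Booleans plus movement modalities). -/
def isBD : Form Pred Cons → Prop
  | .pred _ _ => True
  | .rel _ _ => True
  | .eq _ _ => True
  | .neg φ => isBD φ
  | .and φ ψ => isBD φ ∧ isBD ψ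
  | .Kt _ _ => False
  | .K _ _ => False
  | .box _ φ => isBD φ

/-- Membership in the full language `L`. -/
def isL : Form Pred Cons → Prop
  | .pred _ _ => True
  | .rel _ _ => True
  | .eq _ _ => True
  | .neg φ => isL φ
  | .and φ ψ => isL φ ∧ isL ψ
  | .Kt _ _ => True
  | .K _ ψ => isBD ψ
  | .box _ φ => isL φ

/-- Membership in the static fragment `L⁻`: no movement modalities, and the
knowledge operator `K_z` is applied to `L_B`-formulas only. -/
def isStatic : Form Pred Cons → Prop
  | .pred _ _ => True
  | .rel _ _ => True
  | .eq _ _ => True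
  | .neg φ => isStatic φ
  | .and φ ψ => isStatic φ ∧ isStatic ψ
  | .Kt _ _ => True
  | .K _ φ => isBase φ
  | .box _ _ => False

/-- The variable `z` occurs in the formula. -/
def occurs (z : Var) : Form Pred Cons → Prop
  | .pred _ args => Term.var z ∈ args
  | .rel t₁ t₂ => t₁ = Term.var z ∨ t₂ = Term.var z
  | .eq t₁ t₂ => t₁ = Term.var z ∨ t₂ = Term.var z
  | .neg φ => occurs z φ
  | .and φ ψ => occurs z φ ∨ occurs z ψ
  | .Kt w t => w = z ∨ t = Term.var z
  | .K w φ => w = z ∨ occurs z φ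
  | .box w φ => w = z ∨ occurs z φ

/-- The list of terms occurring in a formula. -/
def termList : Form Pred Cons → List (Term Cons)
  | .pred _ args => args
  | .rel t₁ t₂ => [t₁, t₂]
  | .eq t₁ t₂ => [t₁, t₂]
  | .neg φ => termList φ
  | .and φ ψ => termList φ ++ termList ψ
  | .Kt _ t => [t]
  | .K _ φ => termList φ
  | .box _ φ => termList φ

end Form

/-- Substituting the constant `c` for the variable `z` in a term. -/
def Term.substC {Cons : Type} (c : Cons) (z : Var) : Term Cons → Term Cons
  | .var v => if v = z then .const c else .var v
  | .const c' => .const c'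

/-- `φ.substC c z` is `φ[c/z]`. -/
def Form.substC {Pred Cons : Type} (c : Cons) (z : Var) : Form Pred Cons → Form Pred Cons
  | .pred P args => .pred P (args.map (Term.substC c z))
  | .rel t₁ t₂ => .rel (t₁.substC c z) (t₂.substC c z)
  | .eq t₁ t₂ => .eq (t₁.substC c z) (t₂.substC c z)
  | .neg φ => .neg (φ.substC c z)
  | .and φ ψ => .and (φ.substC c z) (ψ.substC c z)
  | .Kt w t => .Kt w (t.substC c z)
  | .K w φ => .K w (φ.substC c z)
  | .box w φ => .box w (φ.substC c z)

/-- Replacing the term `t₂` by the term `t₁`. -/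
def Term.repl {Cons : Type} [DecidableEq Cons] (t₁ t₂ t : Term Cons) : Term Cons :=
  if t = t₂ then t₁ else t

/-- `φ.replace t₁ t₂` is `φ[t₁/t₂]`: the result of replacing `t₂` in `φ` with `t₁`. -/
def Form.replace {Pred Cons : Type} [DecidableEq Cons] (t₁ t₂ : Term Cons) :
    Form Pred Cons → Form Pred Cons
  | .pred P args => .pred P (args.map (Term.repl t₁ t₂))
  | .rel s₁ s₂ => .rel (Term.repl t₁ t₂ s₁) (Term.repl t₁ t₂ s₂)
  | .eq s₁ s₂ => .eq (Term.repl t₁ t₂ s₁) (Term.repl t₁ t₂ s₂)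
  | .neg φ => .neg (φ.replace t₁ t₂)
  | .and φ ψ => .and (φ.replace t₁ t₂) (ψ.replace t₁ t₂)
  | .Kt w t => .Kt w (Term.repl t₁ t₂ t)
  | .K w φ => .K w (φ.replace t₁ t₂)
  | .box w φ => .box w (φ.replace t₁ t₂)

/-- The list of all terms (constants and variables), for finite `Cons`. -/
noncomputable def allTerms (Cons : Type) [Fintype Cons] : List (Term Cons) :=
  (Finset.univ : Finset Cons).toList.map Term.const ++ [Term.var .x, Term.var .y]

/-- The syntactic distance formulas `D^n t₁ t₂`. -/
noncomputable def distForm (Pred : Type) {Cons : Type} [Fintype Cons] :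
    ℕ → Term Cons → Term Cons → Form Pred Cons
  | 0, t₁, t₂ => .eq t₁ t₂
  | n + 1, t₁, t₂ =>
      Form.or (distForm Pred n t₁ t₂)
        (Form.bigOr ((allTerms Cons).map fun t =>
          Form.and (distForm Pred n t₁ t) (Form.or (.rel t t₂) (.rel t₂ t))))

/-- `K_z z' = T`: the set `T` consists of the possible positions of `z'` considered by `z`. -/
noncomputable def KzEqSet {Pred Cons : Type} [Fintype Cons] [DecidableEq Cons]
    (z z' : Var) (T : Finset Cons) : Form Pred Cons :=
  Form.bigAnd
    ((T.toList.map fun c => Form.diaK z (.eq (.var z') (.const c))) ++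
      (Tᶜ.toList.map fun c => Form.K z (.neg (.eq (.var z') (.const c)))))

/-- `Rz = T`: `T` is exactly the set of (names of) R-successors of `z`. -/
noncomputable def RzEqSet {Pred Cons : Type} [Fintype Cons] [DecidableEq Cons]
    (z : Var) (T : Finset Cons) : Form Pred Cons :=
  Form.bigAnd
    ((T.toList.map fun c => Form.rel (.var z) (.const c)) ++
      (Tᶜ.toList.map fun c => Form.neg (Form.rel (.var z) (.const c))))

/-- The list of all subsets of `Cons`. -/
noncomputable def powList (Cons : Type) [Fintype Cons] [DecidableEq Cons] : List (Finset Cons) :=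
  (Finset.univ : Finset Cons).powerset.toList

/-! ### Semantics -/

/-- An interpretation of the vocabulary over a domain `D`. -/
structure Interp (Pred Cons D : Type) where
  pred : Pred → List D → Prop
  rel : D → D → Prop
  const : Cons → D

/-- Assignments (situations): positions of the two players. -/
abbrev Assign (D : Type) := Var → D

/-- The value of a term at an interpretation and a situation. -/
def Term.val {Pred Cons D : Type} (I : Interp Pred Cons D) (σ : Assign D) :
    Term Cons → D
  | .const c => I.const c
  | .var v => σ v

/-- `Dball I m s` is `D^m(s)`: points reachable from `s` in at most `m` steps
along `I.rel` or its converse. -/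
def Dball {Pred Cons D : Type} (I : Interp Pred Cons D) : ℕ → D → Set D
  | 0, s => {s}
  | m + 1, s => Dball I m s ∪ {t | ∃ u ∈ Dball I m s, I.rel u t ∨ I.rel t u}

/-- `R^z σ σ'`: player `z` moves along an arrow, the other player stays put. -/
def Rstep {Pred Cons D : Type} (I : Interp Pred Cons D) (z : Var) (σ σ' : Assign D) : Prop :=
  I.rel (σ z) (σ' z) ∧ σ z.other = σ' z.other

/-- Indistinguishability data: a relation on assignments for each player. -/
abbrev SimRel (D : Type) := Var → Assign D → Assign D → Prop

/-- `Σ|σ`: the situations related to `σ` by some player's indistinguishability. -/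
def restrict {D : Type} (Sit : Set (Assign D)) (sim : SimRel D) (σ : Assign D) :
    Set (Assign D) :=
  {σ' ∈ Sit | ∃ z, sim z σ σ'}

/-- The updated set of situations after player `z` moves from `σ₁` to `σ₂`. -/
def updSit {Pred Cons D : Type} (k : ℕ) (I : Interp Pred Cons D)
    (Sit : Set (Assign D)) (sim : SimRel D) (z : Var) (σ₁ σ₂ : Assign D) :
    Set (Assign D) :=
  {σ' | (σ₂ Var.x ∈ Dball I k (σ₂ Var.y) ∧ σ' = σ₂) ∨
        (σ₂ Var.x ∉ Dball I k (σ₂ Var.y) ∧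
          (∃ σ ∈ restrict Sit sim σ₁, Rstep I z σ σ') ∧
          σ' Var.x ∉ Dball I k (σ' Var.y))}

/-- The updated indistinguishability relations: `σ₁ ∼'_z σ₂` iff `σ₁ z = σ₂ z`. -/
def updSim (D : Type) : SimRel D := fun z σ₁ σ₂ => σ₁ z = σ₂ z

/-- Satisfaction for `ELCR` (with sight `k`). -/
def Sat {Pred Cons D : Type} (k : ℕ) (I : Interp Pred Cons D) :
    Set (Assign D) → SimRel D → Assign D → Form Pred Cons → Prop
  | _, _, σ, .pred P args => I.pred P (args.map (Term.val I σ))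
  | _, _, σ, .rel t₁ t₂ => I.rel (t₁.val I σ) (t₂.val I σ)
  | _, _, σ, .eq t₁ t₂ => t₁.val I σ = t₂.val I σ
  | Sit, sim, σ, .neg φ => ¬ Sat k I Sit sim σ φ
  | Sit, sim, σ, .and φ ψ => Sat k I Sit sim σ φ ∧ Sat k I Sit sim σ ψ
  | Sit, sim, σ, .Kt z t => ∀ σ' ∈ Sit, sim z σ' σ → t.val I σ = t.val I σ'
  | Sit, sim, σ, .K z φ => ∀ σ' ∈ Sit, sim z σ' σ → Sat k I Sit sim σ' φ
  | Sit, sim, σ, .box z φ => ∀ σ₂, Rstep I z σ σ₂ →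
      Sat k I (updSit k I Sit sim z σ σ₂) (updSim D) σ₂ φ

/-- The conditions making `(D, I, Σ, ∼)` a model: seriality of `I.rel`, every
point named by a constant, `Σ` nonempty, and each `∼_z` an equivalence relation on `Σ`. -/
structure IsModel {Pred Cons D : Type} (I : Interp Pred Cons D)
    (Sit : Set (Assign D)) (sim : SimRel D) : Prop where
  serial : ∀ s, ∃ t, I.rel s t
  const_surj : Function.Surjective I.const
  nonempty : Sit.Nonempty
  sim_mem : ∀ z σ σ', sim z σ σ' → σ ∈ Sit ∧ σ' ∈ Sit
  sim_refl : ∀ z, ∀ σ ∈ Sit, sim z σ σ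
  sim_symm : ∀ z σ σ', sim z σ σ' → sim z σ' σ
  sim_trans : ∀ z σ₁ σ₂ σ₃, sim z σ₁ σ₂ → sim z σ₂ σ₃ → sim z σ₁ σ₃

/-- The `k`-sight condition. -/
def KSight {Pred Cons D : Type} (k : ℕ) (I : Interp Pred Cons D)
    (Sit : Set (Assign D)) (sim : SimRel D) : Prop :=
  ∀ z σ σ', σ ∈ Sit → σ' ∈ Sit → sim z σ σ' →
    ∀ z', σ z' ∈ Dball I k (σ z) → σ z' = σ' z'

/-- A nonempty conjunction `K_zα₁ ∧ ⋯ ∧ K_zαₙ ∧ ⟨K_z⟩β₁ ∧ ⋯ ∧ ⟨K_z⟩βₘ`. -/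
def kConj {Pred Cons : Type} (z : Var) (αs βs : List (Form Pred Cons)) :
    Form Pred Cons :=
  Form.bigAnd (αs.map (Form.K z) ++ βs.map (Form.diaK z))
/-! ### The proof system ELCR⁻ -/

/-- Evaluation of a formula under a propositional valuation of its non-Boolean
components: used to define propositional tautologies. -/
def Form.evalProp {Pred Cons : Type} (v : Form Pred Cons → Prop) :
    Form Pred Cons → Prop
  | .neg φ => ¬ Form.evalProp v φ
  | .and φ ψ => Form.evalProp v φ ∧ Form.evalProp v ψ
  | φ => v φ

/-- Propositional tautologies. -/
def Form.Tautology {Pred Cons : Type} (φ : Form Pred Cons) : Prop :=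
  ∀ v : Form Pred Cons → Prop, Form.evalProp v φ

/-- The Hilbert-style proof system `ELCR⁻` for the static fragment, with sight `k`. -/
inductive Prov {Pred Cons : Type} [Fintype Cons] [DecidableEq Cons] (k : ℕ) :
    Form Pred Cons → Prop
  | taut {φ : Form Pred Cons} : φ.isStatic → φ.Tautology → Prov k φ
  | mp {φ ψ : Form Pred Cons} : Prov k (φ.imp ψ) → Prov k φ → Prov k ψ
  | eqRefl (t : Term Cons) : Prov k (.eq t t)
  | eqSymm (t₁ t₂ : Term Cons) : Prov k ((Form.eq t₁ t₂).imp (.eq t₂ t₁))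
  | eqTrans (t₁ t₂ t₃ : Term Cons) :
      Prov k (((Form.eq t₁ t₂).and (.eq t₂ t₃)).imp (.eq t₁ t₃))
  | eqSubst {α : Form Pred Cons} (t₁ t₂ : Term Cons) : α.isBase →
      Prov k ((Form.eq t₁ t₂).imp (α.iffF (α.replace t₁ t₂)))
  | seriality (c : Cons) :
      Prov k (Form.bigOr ((Finset.univ : Finset Cons).toList.map fun t =>
        Form.rel (.const c) (.const t)))
  | atSomewhere (z : Var) :
      Prov k (Form.bigOr ((Finset.univ : Finset Cons).toList.map fun c =>
        Form.eq (.var z) (.const c)))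
  | ksight (z : Var) (t : Term Cons) :
      Prov k ((distForm Pred k (.var z) t).imp (.Kt z t))
  | kAx {α β : Form Pred Cons} (z : Var) : α.isBase → β.isBase →
      Prov k ((Form.K z (α.imp β)).imp ((Form.K z α).imp (.K z β)))
  | tAx {α : Form Pred Cons} (z : Var) : α.isBase →
      Prov k ((Form.K z α).imp α)
  | kGround {α : Form Pred Cons} (z : Var) (T : Finset Cons) : α.isBase →
      Prov k ((KzEqSet z z.other T).imp
        ((Form.K z α).iffF (Form.bigAnd (T.toList.map fun c => α.substC c z.other))))
  | kAdd {α : Form Pred Cons} (z : Var) (αs βs : List (Form Pred Cons)) :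
      α.isBase → (∀ γ ∈ αs, γ.isBase) → (∀ γ ∈ βs, γ.isBase) →
      1 ≤ αs.length + βs.length →
      Prov k ((kConj z αs βs).imp α) → Prov k ((kConj z αs βs).imp (.K z α))
  | kElim {α β : Form Pred Cons} (z : Var) (αs βs : List (Form Pred Cons)) :
      α.isBase → β.isBase → (∀ γ ∈ αs, γ.isBase) → (∀ γ ∈ βs, γ.isBase) →
      1 ≤ αs.length + βs.length →
      Prov k ((kConj z.other αs βs).imp ((Form.K z α).imp β)) →
      Prov k ((kConj z.other αs βs).imp (α.imp β))
  | deRe (z : Var) (t : Term Cons) (c : Cons) :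
      Prov k ((Form.eq t (.const c)).imp
        ((Form.Kt z t).iffF (.K z (.eq t (.const c)))))
  | structK {α : Form Pred Cons} (z : Var) (T : Finset (Term Cons)) : α.isBase →
      (∀ t ∈ α.termList, t ∈ T) →
      Prov k (((Form.bigAnd (T.toList.map (Form.Kt z))).and α).imp (.K z α))

/-- A set of formulas is consistent if no finite conjunction from it proves `⊥`. -/
def consistentS {Pred Cons : Type} [Fintype Cons] [DecidableEq Cons] (k : ℕ)
    (Γ : Set (Form Pred Cons)) : Prop :=
  ¬ ∃ l : List (Form Pred Cons), (∀ φ ∈ l, φ ∈ Γ) ∧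
      Prov k ((Form.bigAnd l).imp Form.falseF)

/-- Maximally consistent sets of `L⁻`-formulas. -/
def MCS {Pred Cons : Type} [Fintype Cons] [DecidableEq Cons] (k : ℕ)
    (Δ : Set (Form Pred Cons)) : Prop :=
  consistentS k Δ ∧ (∀ φ ∈ Δ, Form.isStatic φ) ∧
    ∀ φ : Form Pred Cons, φ.isStatic → φ ∈ Δ ∨ Form.neg φ ∈ Δ

/-- All terms of the formula are constants. -/
def isConsOnly {Pred Cons : Type} (φ : Form Pred Cons) : Prop :=
  ∀ t ∈ φ.termList, ∃ c : Cons, t = Term.const c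

/-- `Δ₁ =^Cons Δ₂`: the two sets contain the same `L_B`-formulas whose terms are
all constants. -/
def consEq {Pred Cons : Type} (Δ₁ Δ₂ : Set (Form Pred Cons)) : Prop :=
  ∀ α : Form Pred Cons, α.isBase → isConsOnly α → (α ∈ Δ₁ ↔ α ∈ Δ₂)
/-! ### The canonical model -/

/-- The equivalence class of the constant `c` determined by `Δ₀`. -/
def eqClass {Pred Cons : Type} (Δ₀ : Set (Form Pred Cons)) (c : Cons) : Set Cons :=
  {c' | Form.eq (Term.const c') (Term.const c) ∈ Δ₀}

/-- The canonical domain: equivalence classes of constants. -/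
def CanD {Pred Cons : Type} (Δ₀ : Set (Form Pred Cons)) : Type :=
  {S : Set Cons // ∃ c, S = eqClass Δ₀ c}

/-- `[c]`, as an element of the canonical domain. -/
def canConst {Pred Cons : Type} (Δ₀ : Set (Form Pred Cons)) (c : Cons) : CanD Δ₀ :=
  ⟨eqClass Δ₀ c, c, rfl⟩

/-- The canonical interpretation. -/
def canI {Pred Cons : Type} (Δ₀ : Set (Form Pred Cons)) : Interp Pred Cons (CanD Δ₀) where
  pred P ds := ∃ cs : List Cons, ds = cs.map (canConst Δ₀) ∧
    Form.pred P (cs.map Term.const) ∈ Δ₀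
  rel d₁ d₂ := ∃ c₁ c₂, d₁ = canConst Δ₀ c₁ ∧ d₂ = canConst Δ₀ c₂ ∧
    Form.rel (Term.const c₁) (Term.const c₂) ∈ Δ₀
  const := canConst Δ₀

/-- `K_z Δ := {α : K_z α ∈ Δ}`. -/
def Kset {Pred Cons : Type} (z : Var) (Δ : Set (Form Pred Cons)) : Set (Form Pred Cons) :=
  {α | Form.K z α ∈ Δ}

/-- The canonical set of situations, as a collection of MCSs. -/
def CanSit {Pred Cons : Type} [Fintype Cons] [DecidableEq Cons] (k : ℕ)
    (Δ₀ : Set (Form Pred Cons)) (Ty Tx : Finset Cons) (cx cy : Cons) :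
    Set (Set (Form Pred Cons)) :=
  {Δ₀} ∪
  {Δ | MCS k Δ ∧ consEq Δ Δ₀ ∧ KzEqSet Var.x Var.y Ty ∈ Δ ∧
      Form.K Var.y (Form.eq (.var .x) (.const cx)) ∈ Δ ∧
      ∃ c ∈ Ty, Form.eq (.var .y) (.const c) ∈ Δ ∧
        Form.neg (Form.eq (.const c) (.const cy)) ∈ Δ} ∪
  {Δ | MCS k Δ ∧ consEq Δ Δ₀ ∧ KzEqSet Var.y Var.x Tx ∈ Δ ∧
      Form.K Var.x (Form.eq (.var .y) (.const cy)) ∈ Δ ∧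
      ∃ c ∈ Tx, Form.eq (.var .x) (.const c) ∈ Δ ∧
        Form.neg (Form.eq (.const c) (.const cx)) ∈ Δ}

/-- The assignment induced by an MCS `Δ`: `Δ(z) = [c]` whenever `z ≡ c ∈ Δ`. -/
noncomputable def canAsg {Pred Cons : Type} [Nonempty Cons]
    (Δ₀ Δ : Set (Form Pred Cons)) : Assign (CanD Δ₀) := fun z =>
  canConst Δ₀ (open Classical in
    if h : ∃ c : Cons, Form.eq (Term.var z) (Term.const c) ∈ Δ then h.choose
    else Classical.arbitrary Cons)

/-- The canonical set of situations, as a set of assignments. -/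
noncomputable def CanSitA {Pred Cons : Type} [Fintype Cons] [DecidableEq Cons] [Nonempty Cons]
    (k : ℕ) (Δ₀ : Set (Form Pred Cons)) (Ty Tx : Finset Cons) (cx cy : Cons) :
    Set (Assign (CanD Δ₀)) :=
  canAsg Δ₀ '' CanSit k Δ₀ Ty Tx cx cy

/-- The canonical indistinguishability relations: `Δ₁ ∼_z Δ₂` iff `K_z Δ₁ = K_z Δ₂`. -/
def canSim {Pred Cons : Type} [Nonempty Cons] (Δ₀ : Set (Form Pred Cons))
    (S : Set (Set (Form Pred Cons))) : SimRel (CanD Δ₀) := fun z σ₁ σ₂ =>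
  ∃ Δ₁ ∈ S, ∃ Δ₂ ∈ S, σ₁ = canAsg Δ₀ Δ₁ ∧ σ₂ = canAsg Δ₀ Δ₂ ∧ Kset z Δ₁ = Kset z Δ₂

/-! ### Syntactic preliminaries -/

namespace Form

variable {Pred Cons : Type}

theorem isStatic_of_isBase {φ : Form Pred Cons} (h : φ.isBase) : φ.isStatic := by
  induction φ with
  | pred | rel | eq => trivial
  | neg φ ih => exact ih h
  | and φ ψ ih₁ ih₂ => exact ⟨ih₁ h.1, ih₂ h.2⟩
  | Kt | K | box => exact h.elim

@[simp] theorem isStatic_neg {φ : Form Pred Cons} : φ.neg.isStatic ↔ φ.isStatic := Iff.rfl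

@[simp] theorem isStatic_and {φ ψ : Form Pred Cons} :
    (φ.and ψ).isStatic ↔ φ.isStatic ∧ ψ.isStatic := Iff.rfl

@[simp] theorem isStatic_imp {φ ψ : Form Pred Cons} :
    (φ.imp ψ).isStatic ↔ φ.isStatic ∧ ψ.isStatic := Iff.rfl

@[simp] theorem isStatic_or {φ ψ : Form Pred Cons} :
    (φ.or ψ).isStatic ↔ φ.isStatic ∧ ψ.isStatic := Iff.rfl

theorem isStatic_bigAnd {l : List (Form Pred Cons)} :
    (bigAnd l).isStatic ↔ ∀ φ ∈ l, φ.isStatic := by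
  induction l with
  | nil => simp [bigAnd, trueF, falseF, isStatic]
  | cons a l ih => simp [bigAnd, ih]

theorem isBase_bigAnd {l : List (Form Pred Cons)} (h : ∀ φ ∈ l, φ.isBase) :
    (bigAnd l).isBase := by
  induction l with
  | nil => simp [bigAnd, trueF, falseF, isBase]
  | cons a l ih =>
    exact ⟨h a (by simp), ih fun φ hφ => h φ (by simp [hφ])⟩

theorem isStatic_bigOr {l : List (Form Pred Cons)} :
    (bigOr l).isStatic ↔ ∀ φ ∈ l, φ.isStatic := by
  induction l with
  | nil => simp [bigOr, falseF, isStatic]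
  | cons a l ih => simp [bigOr, ih]

theorem isBase_bigOr {l : List (Form Pred Cons)} (h : ∀ φ ∈ l, φ.isBase) :
    (bigOr l).isBase := by
  induction l with
  | nil => simp [bigOr, falseF, isBase]
  | cons a l ih =>
    exact ⟨h a (by simp), ih fun φ hφ => h φ (by simp [hφ])⟩

theorem isBase_distForm [Fintype Cons] (n : ℕ) (t₁ t₂ : Term Cons) :
    (distForm Pred n t₁ t₂).isBase := by
  induction n generalizing t₂ with
  | zero => trivial
  | succ n ih =>
    refine ⟨ih t₂, isBase_bigOr fun φ hφ => ?_⟩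
    obtain ⟨t, -, rfl⟩ := List.mem_map.1 hφ
    exact ⟨ih t, trivial, trivial⟩

theorem evalProp_bigAnd (v : Form Pred Cons → Prop) (l : List (Form Pred Cons)) :
    evalProp v (bigAnd l) ↔ v (.eq (.var .x) (.var .x)) ∧ ∀ φ ∈ l, evalProp v φ := by
  induction l with
  | nil => simp [bigAnd, trueF, falseF, evalProp]
  | cons a l ih =>
    simp only [bigAnd, evalProp, ih, List.forall_mem_cons]
    tauto

theorem evalProp_imp (v : Form Pred Cons → Prop) (φ ψ : Form Pred Cons) :
    evalProp v (φ.imp ψ) ↔ (evalProp v φ → evalProp v ψ) := by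
  simp [imp, evalProp]

/-- Applying a map to every term of a formula. -/
def mapTerms (g : Term Cons → Term Cons) : Form Pred Cons → Form Pred Cons
  | .pred P args => .pred P (args.map g)
  | .rel t₁ t₂ => .rel (g t₁) (g t₂)
  | .eq t₁ t₂ => .eq (g t₁) (g t₂)
  | .neg φ => .neg (φ.mapTerms g)
  | .and φ ψ => .and (φ.mapTerms g) (ψ.mapTerms g)
  | .Kt w t => .Kt w (g t)
  | .K w φ => .K w (φ.mapTerms g)
  | .box w φ => .box w (φ.mapTerms g)

theorem mapTerms_mapTerms (f g : Term Cons → Term Cons) (φ : Form Pred Cons) :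
    (φ.mapTerms g).mapTerms f = φ.mapTerms (f ∘ g) := by
  induction φ <;> simp_all [mapTerms]

theorem mapTerms_eq_self {g : Term Cons → Term Cons} {φ : Form Pred Cons}
    (h : ∀ t ∈ φ.termList, g t = t) : φ.mapTerms g = φ := by
  induction φ with
  | pred P args =>
    simp only [mapTerms, pred.injEq, true_and]
    exact (List.map_congr_left h).trans (List.map_id' args)
  | _ => simp_all [mapTerms, termList]

theorem termList_mapTerms (g : Term Cons → Term Cons) (φ : Form Pred Cons) :
    (φ.mapTerms g).termList = φ.termList.map g := by
  induction φ <;> simp_all [mapTerms, termList]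

theorem isBase_mapTerms {g : Term Cons → Term Cons} {φ : Form Pred Cons} :
    (φ.mapTerms g).isBase ↔ φ.isBase := by
  induction φ <;> simp_all [mapTerms, isBase]

theorem replace_eq_mapTerms [DecidableEq Cons] (t₁ t₂ : Term Cons) (φ : Form Pred Cons) :
    φ.replace t₁ t₂ = φ.mapTerms (Term.repl t₁ t₂) := by
  induction φ <;> simp_all [mapTerms, replace]

theorem substC_eq_mapTerms (c : Cons) (z : Var) (φ : Form Pred Cons) :
    φ.substC c z = φ.mapTerms (Term.substC c z) := by
  induction φ <;> simp_all [mapTerms, substC]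

theorem isBase_substC {c : Cons} {z : Var} {φ : Form Pred Cons} :
    (φ.substC c z).isBase ↔ φ.isBase := by
  rw [substC_eq_mapTerms, isBase_mapTerms]

end Form

theorem Term.substC_substC_other {Cons : Type} (c d : Cons) (z : Var) (t : Term Cons) :
    ∃ e, Term.substC d z (Term.substC c z.other t) = .const e := by
  rcases t with e | v
  · exact ⟨e, rfl⟩
  · cases z <;> cases v <;> simp [Term.substC, Var.other]

theorem isConsOnly_substC_substC_other {Pred Cons : Type} (c d : Cons) (z : Var)
    (φ : Form Pred Cons) : isConsOnly ((φ.substC c z.other).substC d z) := by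
  intro t ht
  simp only [Form.substC_eq_mapTerms, Form.termList_mapTerms, List.map_map, List.mem_map] at ht
  obtain ⟨s, -, rfl⟩ := ht
  exact Term.substC_substC_other c d z s

@[simp] theorem Var.other_other (z : Var) : z.other.other = z := by cases z <;> rfl

theorem Var.eq_or_eq_other (v z : Var) : v = z ∨ v = z.other := by
  cases v <;> cases z <;> simp [Var.other]

theorem isStatic_kConj {Pred Cons : Type} {z : Var} {αs βs : List (Form Pred Cons)}
    (hα : ∀ γ ∈ αs, γ.isBase) (hβ : ∀ γ ∈ βs, γ.isBase) : (kConj z αs βs).isStatic := by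
  refine Form.isStatic_bigAnd.2 fun φ hφ => ?_
  rcases List.mem_append.1 hφ with h | h <;> obtain ⟨γ, hγ, rfl⟩ := List.mem_map.1 h
  · exact hα γ hγ
  · exact hβ γ hγ

theorem mem_allTerms {Cons : Type} [Fintype Cons] (t : Term Cons) : t ∈ allTerms Cons := by
  rcases t with c | v
  · simp [allTerms]
  · cases v <;> simp [allTerms]

theorem List.map_eq_map_of_factors {α β γ : Type*} {g : α → β} {h : α → γ}
    (hgh : ∀ a b, g a = g b → h a = h b) {l m : List α} (hlm : l.map g = m.map g) :
    l.map h = m.map h := by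
  induction l generalizing m with
  | nil => simpa [eq_comm] using hlm
  | cons a l ih =>
    cases m with
    | nil => simp at hlm
    | cons b m =>
      simp only [List.map_cons, List.cons.injEq] at hlm ⊢
      exact ⟨hgh a b hlm.1, ih hlm.2⟩

/-! ### Maximal consistent sets -/

section

variable {Pred Cons : Type} [Fintype Cons] [DecidableEq Cons] {k : ℕ}

open Form

theorem Prov.of_evalProp {φ ψ χ : Form Pred Cons} (hφ : Prov k φ) (hψ : Prov k ψ)
    (sφ : φ.isStatic) (sψ : ψ.isStatic) (sχ : χ.isStatic)
    (h : ∀ v : Form Pred Cons → Prop, v (.eq (.var .x) (.var .x)) →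
      evalProp v φ → evalProp v ψ → evalProp v χ) : Prov k χ := by
  have ht : Prov k ((Form.eq (.var .x) (.var .x)).imp (φ.imp (ψ.imp χ))) := by
    refine .taut (by simp [isStatic, *]) fun v => ?_
    simp only [evalProp_imp]
    exact h v
  exact ((ht.mp (.eqRefl _)).mp hφ).mp hψ

namespace MCS

variable {Δ : Set (Form Pred Cons)}

theorem isStatic (hΔ : MCS k Δ) {φ : Form Pred Cons} (h : φ ∈ Δ) : φ.isStatic := hΔ.2.1 φ h

theorem mem_of_prov_bigAnd_imp (hΔ : MCS k Δ) {l : List (Form Pred Cons)}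
    (hl : ∀ ψ ∈ l, ψ ∈ Δ) {φ : Form Pred Cons} (sφ : φ.isStatic)
    (h : Prov k ((bigAnd l).imp φ)) : φ ∈ Δ := by
  refine (hΔ.2.2 φ sφ).resolve_right fun hn => hΔ.1 ⟨φ.neg :: l, ?_, ?_⟩
  · simpa [hn] using hl
  · have sl : (bigAnd l).isStatic := isStatic_bigAnd.2 fun ψ hψ => hΔ.isStatic (hl ψ hψ)
    refine h.of_evalProp h (by simp [*]) (by simp [*])
      (by simp [*, bigAnd, falseF, Form.isStatic]) fun v hv h₁ _ => ?_
    simp only [evalProp_imp, bigAnd, evalProp] at *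
    tauto

theorem mem_of_prov (hΔ : MCS k Δ) {φ : Form Pred Cons} (sφ : φ.isStatic)
    (h : Prov k φ) : φ ∈ Δ := by
  refine hΔ.mem_of_prov_bigAnd_imp (l := []) (by simp) sφ ?_
  refine h.of_evalProp h sφ sφ (by simp [sφ, isStatic_bigAnd]) fun v _ h₁ _ => ?_
  simp [evalProp_imp, h₁]

theorem mem_of_evalProp (hΔ : MCS k Δ) {l : List (Form Pred Cons)}
    (hl : ∀ ψ ∈ l, ψ ∈ Δ) {φ : Form Pred Cons} (sφ : φ.isStatic)
    (h : ∀ v : Form Pred Cons → Prop, (∀ ψ ∈ l, evalProp v ψ) → evalProp v φ) : φ ∈ Δ := by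
  refine hΔ.mem_of_prov_bigAnd_imp hl sφ (.taut ?_ fun v => ?_)
  · simpa [sφ, isStatic_bigAnd] using fun ψ hψ => hΔ.isStatic (hl ψ hψ)
  · rw [evalProp_imp, evalProp_bigAnd]
    exact fun h' => h v h'.2

theorem falseF_notMem (hΔ : MCS k Δ) : falseF ∉ Δ := fun h =>
  hΔ.1 ⟨[falseF], by simpa using h, .taut (by simp [bigAnd, trueF, falseF, Form.isStatic])
    fun v => by
      simp only [evalProp_imp, bigAnd, evalProp]
      exact And.left⟩

theorem neg_mem (hΔ : MCS k Δ) {φ : Form Pred Cons} (sφ : φ.isStatic) :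
    φ.neg ∈ Δ ↔ φ ∉ Δ := by
  refine ⟨fun hn h => hΔ.falseF_notMem ?_, (hΔ.2.2 φ sφ).resolve_left⟩
  refine hΔ.mem_of_evalProp (l := [φ, φ.neg]) (by simp [*])
    (by simp [falseF, Form.isStatic]) fun v hv => ?_
  simp [evalProp] at hv

theorem and_mem (hΔ : MCS k Δ) {φ ψ : Form Pred Cons} :
    φ.and ψ ∈ Δ ↔ φ ∈ Δ ∧ ψ ∈ Δ := by
  refine ⟨fun h => ⟨?_, ?_⟩, fun h => ?_⟩
  · exact hΔ.mem_of_evalProp (l := [φ.and ψ]) (by simpa) (hΔ.isStatic h).1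
      fun v hv => by simp [evalProp] at hv; exact hv.1
  · exact hΔ.mem_of_evalProp (l := [φ.and ψ]) (by simpa) (hΔ.isStatic h).2
      fun v hv => by simp [evalProp] at hv; exact hv.2
  · exact hΔ.mem_of_evalProp (l := [φ, ψ]) (by simpa)
      ⟨hΔ.isStatic h.1, hΔ.isStatic h.2⟩ fun v hv => by simpa [evalProp] using hv

theorem imp_mem (hΔ : MCS k Δ) {φ ψ : Form Pred Cons} (sφ : φ.isStatic) (sψ : ψ.isStatic) :
    φ.imp ψ ∈ Δ ↔ (φ ∈ Δ → ψ ∈ Δ) := by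
  rw [imp, hΔ.neg_mem (by simp [*]), hΔ.and_mem, hΔ.neg_mem sψ]
  tauto

theorem or_mem (hΔ : MCS k Δ) {φ ψ : Form Pred Cons} (sφ : φ.isStatic) (sψ : ψ.isStatic) :
    φ.or ψ ∈ Δ ↔ (φ ∈ Δ ∨ ψ ∈ Δ) := by
  rw [Form.or, hΔ.neg_mem (by simp [*]), hΔ.and_mem, hΔ.neg_mem sψ, hΔ.neg_mem sφ]
  tauto

theorem iffF_mem (hΔ : MCS k Δ) {φ ψ : Form Pred Cons} (sφ : φ.isStatic) (sψ : ψ.isStatic) :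
    φ.iffF ψ ∈ Δ ↔ (φ ∈ Δ ↔ ψ ∈ Δ) := by
  rw [iffF, hΔ.and_mem, hΔ.imp_mem sφ sψ, hΔ.imp_mem sψ sφ]
  exact iff_iff_implies_and_implies.symm

theorem bigAnd_mem (hΔ : MCS k Δ) {l : List (Form Pred Cons)} :
    bigAnd l ∈ Δ ↔ ∀ φ ∈ l, φ ∈ Δ := by
  induction l with
  | nil =>
    simp only [bigAnd, trueF, List.not_mem_nil, false_implies, implies_true, iff_true]
    rw [hΔ.neg_mem (by simp [falseF, Form.isStatic])]
    exact hΔ.falseF_notMem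
  | cons a l ih => rw [bigAnd, hΔ.and_mem, ih, List.forall_mem_cons]

theorem exists_mem_of_bigOr_mem (hΔ : MCS k Δ) {l : List (Form Pred Cons)}
    (h : bigOr l ∈ Δ) : ∃ φ ∈ l, φ ∈ Δ := by
  induction l with
  | nil => exact (hΔ.falseF_notMem h).elim
  | cons a l ih =>
    have hs := isStatic_or.1 (hΔ.isStatic h)
    rcases (hΔ.or_mem hs.1 hs.2).1 h with h | h
    · exact ⟨a, by simp, h⟩
    · obtain ⟨φ, hφ, h⟩ := ih h
      exact ⟨φ, by simp [hφ], h⟩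

theorem mem_of_prov_imp (hΔ : MCS k Δ) {φ ψ : Form Pred Cons} (h : Prov k (φ.imp ψ))
    (sψ : ψ.isStatic) (hφ : φ ∈ Δ) : ψ ∈ Δ :=
  (hΔ.imp_mem (hΔ.isStatic hφ) sψ).1
    (hΔ.mem_of_prov (isStatic_imp.2 ⟨hΔ.isStatic hφ, sψ⟩) h) hφ

end MCS

/-- **Lindenbaum's Lemma.** -/
theorem consistentS.exists_MCS {Γ : Set (Form Pred Cons)} (hΓ : consistentS k Γ)
    (sΓ : ∀ φ ∈ Γ, φ.isStatic) : ∃ Δ, Γ ⊆ Δ ∧ MCS k Δ := by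
  classical
  obtain ⟨Δ, hΓΔ, hmax⟩ := zorn_subset_nonempty
    {Γ : Set (Form Pred Cons) | consistentS k Γ ∧ ∀ φ ∈ Γ, φ.isStatic} (by
      intro C hC hchain hne
      refine ⟨⋃₀ C, ⟨?_, ?_⟩, fun s hs => Set.subset_sUnion_of_mem hs⟩
      · rintro ⟨l, hl, hp⟩
        obtain ⟨s, hs, hls⟩ := hchain.directedOn.exists_mem_subset_of_finite_of_subset_sUnion
          hne l.finite_toSet hl
        exact (hC hs).1 ⟨l, hls, hp⟩
      · rintro φ ⟨s, hs, hφ⟩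
        exact (hC hs).2 φ hφ) Γ ⟨hΓ, sΓ⟩
  have hΔ := hmax.prop
  have key : ∀ φ : Form Pred Cons, φ.isStatic → φ ∉ Δ →
      ∃ l : List (Form Pred Cons), (∀ ψ ∈ l, ψ ∈ Δ) ∧ Prov k ((bigAnd l).imp φ.neg) := by
    intro φ sφ hφ
    have hins : ¬ consistentS k (insert φ Δ) := fun hc =>
      hφ (hmax.le_of_ge (y := insert φ Δ)
        ⟨hc, by simpa [sφ] using hΔ.2⟩ (Set.subset_insert _ _) (Set.mem_insert _ _))
    obtain ⟨l, hl, hp⟩ := not_not.1 hins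
    have sl : ∀ ψ ∈ l, ψ.isStatic := fun ψ hψ =>
      (hl ψ hψ).elim (fun h => h ▸ sφ) (hΔ.2 ψ)
    refine ⟨l.filter (· ≠ φ), fun ψ hψ => ?_, ?_⟩
    · simp only [ne_eq, decide_not, List.mem_filter, Bool.not_eq_eq_eq_not, Bool.not_true,
        decide_eq_false_iff_not] at hψ
      exact (hl ψ hψ.1).resolve_left hψ.2
    · refine hp.of_evalProp hp ?_ ?_ ?_ fun v hv h₁ _ => ?_
      · simpa [isStatic_bigAnd, falseF, isStatic] using sl
      · simpa [isStatic_bigAnd, falseF, isStatic] using sl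
      · simpa [isStatic_bigAnd, sφ] using fun ψ hψ _ => sl ψ hψ
      · simp only [evalProp_imp, evalProp_bigAnd, falseF, evalProp, hv, true_and] at h₁ ⊢
        intro h₂ h₃
        refine h₁ (fun ψ hψ => ?_) trivial
        by_cases h : ψ = φ
        · exact h ▸ h₃
        · exact h₂ ψ (by simp [hψ, h])
  refine ⟨Δ, hΓΔ, hΔ.1, hΔ.2, fun φ sφ => ?_⟩
  by_contra! hcon
  obtain ⟨l₁, hl₁, hp₁⟩ := key φ sφ hcon.1
  obtain ⟨l₂, hl₂, hp₂⟩ := key φ.neg sφ hcon.2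
  have s₁ := fun ψ hψ => hΔ.2 ψ (hl₁ ψ hψ)
  have s₂ := fun ψ hψ => hΔ.2 ψ (hl₂ ψ hψ)
  refine hΔ.1 ⟨l₁ ++ l₂, fun ψ hψ => (List.mem_append.1 hψ).elim (hl₁ ψ) (hl₂ ψ), ?_⟩
  refine hp₁.of_evalProp hp₂ (by simpa [isStatic_bigAnd, sφ] using s₁)
    (by simpa [isStatic_bigAnd, sφ] using s₂) ?_ fun v hv h₁ h₂ => ?_
  · simpa [isStatic_bigAnd, falseF, isStatic] using
      fun ψ hψ => Or.elim hψ (s₁ ψ) (s₂ ψ)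
  · simp only [evalProp_imp, evalProp_bigAnd, evalProp, hv, true_and, List.mem_append] at h₁ h₂ ⊢
    exact fun h => (h₂ fun ψ hψ => h ψ (.inr hψ)) (h₁ fun ψ hψ => h ψ (.inl hψ)) |>.elim

theorem Prov.of_forall_MCS {φ : Form Pred Cons} (sφ : φ.isStatic)
    (h : ∀ Δ, MCS k Δ → φ ∈ Δ) : Prov k φ := by
  by_contra hφ
  have hc : consistentS k {φ.neg} := by
    rintro ⟨l, hl, hp⟩
    have sl : ∀ ψ ∈ l, ψ.isStatic := fun ψ hψ => by
      rw [Set.mem_singleton_iff.1 (hl ψ hψ)]; exact sφ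
    have sp : ((bigAnd l).imp falseF).isStatic := by
      simpa [isStatic_bigAnd, falseF, isStatic] using sl
    refine hφ (hp.of_evalProp hp sp sp sφ fun v hv h₁ _ => ?_)
    simp only [evalProp_imp, evalProp_bigAnd, falseF, evalProp, hv, true_and] at h₁
    by_contra hn
    exact h₁ (fun ψ hψ => by rw [Set.mem_singleton_iff.1 (hl ψ hψ)]; exact hn) trivial
  obtain ⟨Δ, hsub, hΔ⟩ := hc.exists_MCS (by simpa)
  exact (hΔ.neg_mem sφ).1 (hsub rfl) (h Δ hΔ)

/-! ### Equality and knowledge in maximal consistent sets -/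

namespace MCS

variable {Δ Δ' : Set (Form Pred Cons)}

theorem eq_refl_mem (hΔ : MCS k Δ) (t : Term Cons) : Form.eq t t ∈ Δ :=
  hΔ.mem_of_prov trivial (.eqRefl t)

theorem eq_symm_mem (hΔ : MCS k Δ) {s t : Term Cons} (h : Form.eq s t ∈ Δ) : Form.eq t s ∈ Δ :=
  hΔ.mem_of_prov_imp (.eqSymm s t) trivial h

theorem eq_trans_mem (hΔ : MCS k Δ) {s t u : Term Cons} (h₁ : Form.eq s t ∈ Δ)
    (h₂ : Form.eq t u ∈ Δ) : Form.eq s u ∈ Δ :=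
  hΔ.mem_of_prov_imp (.eqTrans s t u) trivial (hΔ.and_mem.2 ⟨h₁, h₂⟩)

theorem exists_eq_const_mem (hΔ : MCS k Δ) (t : Term Cons) :
    ∃ c, Form.eq t (.const c) ∈ Δ := by
  rcases t with c | v
  · exact ⟨c, hΔ.eq_refl_mem _⟩
  · have h := hΔ.mem_of_prov (isStatic_bigOr.2 (by simp [Form.isStatic])) (.atSomewhere v)
    obtain ⟨φ, hφ, h⟩ := hΔ.exists_mem_of_bigOr_mem h
    obtain ⟨c, -, rfl⟩ := List.mem_map.1 hφ
    exact ⟨c, h⟩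

/-- A choice of representatives of the classes of terms that are equal according to `Δ`. -/
theorem exists_canonical (hΔ : MCS k Δ) : ∃ f : Term Cons → Term Cons,
    (∀ t, Form.eq t (f t) ∈ Δ) ∧ ∀ s t, Form.eq s t ∈ Δ → f s = f t := by
  let S : Setoid (Term Cons) := ⟨fun s t => Form.eq s t ∈ Δ, hΔ.eq_refl_mem, hΔ.eq_symm_mem,
    hΔ.eq_trans_mem⟩
  refine ⟨fun t => (Quotient.mk S t).out, fun t => hΔ.eq_symm_mem (Quotient.mk_out (s := S) t),
    fun s t h => ?_⟩
  exact congrArg Quotient.out (Quotient.sound (s := S) h)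

theorem mapTerms_canonical_mem (hΔ : MCS k Δ) {f : Term Cons → Term Cons}
    (hf : ∀ t, Form.eq t (f t) ∈ Δ) (hf' : ∀ s t, Form.eq s t ∈ Δ → f s = f t)
    {α : Form Pred Cons} (hα : α.isBase) : α.mapTerms f ∈ Δ ↔ α ∈ Δ := by
  have key : ∀ l : List (Term Cons),
      α.mapTerms (fun t => if t ∈ l then f t else t) ∈ Δ ↔ α ∈ Δ := by
    intro l
    induction l with
    | nil => simp [mapTerms_eq_self]
    | cons t l ih =>
      rw [← ih]
      set β := α.mapTerms (fun t => if t ∈ l then f t else t) with hβ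
      have hb : β.isBase := isBase_mapTerms.2 hα
      have hb' : (β.replace (f t) t).isBase := by
        rw [replace_eq_mapTerms]; exact isBase_mapTerms.2 hb
      have h := hΔ.mem_of_prov_imp (.eqSubst (f t) t hb)
        (by simp [iffF, isStatic_of_isBase, hb, hb']) (hΔ.eq_symm_mem (hf t))
      rw [hΔ.iffF_mem (isStatic_of_isBase hb) (isStatic_of_isBase hb')] at h
      rw [h, replace_eq_mapTerms, hβ, mapTerms_mapTerms]
      suffices heq : (fun s => if s ∈ t :: l then f s else s) =
          Term.repl (f t) t ∘ fun s => if s ∈ l then f s else s by rw [heq]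
      funext s
      have hff : f (f s) = f s := (hf' _ _ (hf s)).symm
      simp only [Function.comp, Term.repl, List.mem_cons]
      by_cases h₁ : s ∈ l
      · by_cases h₂ : f s = t
        · simp [h₁, ← h₂, hff]
        · simp [h₁, h₂]
      · by_cases h₂ : s = t
        · rw [h₂] at h₁
          simp [h₁, h₂]
        · simp [h₁, h₂]
  simpa [mem_allTerms] using key (allTerms Cons)

/-- Congruence: terms may be replaced by equal ones. -/
theorem mapTerms_mem (hΔ : MCS k Δ) {g : Term Cons → Term Cons}
    (hg : ∀ t, Form.eq t (g t) ∈ Δ) {α : Form Pred Cons} (hα : α.isBase) :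
    α.mapTerms g ∈ Δ ↔ α ∈ Δ := by
  obtain ⟨f, hf, hf'⟩ := hΔ.exists_canonical
  rw [← hΔ.mapTerms_canonical_mem hf hf' hα,
    ← hΔ.mapTerms_canonical_mem hf hf' (isBase_mapTerms.2 hα), mapTerms_mapTerms]
  have : f ∘ g = f := funext fun t => (hf' _ _ (hg t)).symm
  rw [this]

theorem canConst_eq_iff (hΔ : MCS k Δ) {c d : Cons} :
    canConst Δ c = canConst Δ d ↔ Form.eq (.const c) (.const d) ∈ Δ := by
  refine ⟨fun h => ?_, fun h => Subtype.ext <| Set.ext fun e =>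
    ⟨fun h' => hΔ.eq_trans_mem h' h, fun h' => hΔ.eq_trans_mem h' (hΔ.eq_symm_mem h)⟩⟩
  have hcd : eqClass Δ c = eqClass Δ d := congrArg Subtype.val h
  have hc : c ∈ eqClass Δ c := hΔ.eq_refl_mem (.const c)
  rwa [hcd] at hc

theorem canI_pred_iff (hΔ : MCS k Δ) {P : Pred} {cs : List Cons} :
    (canI Δ).pred P (cs.map (canConst Δ)) ↔ Form.pred P (cs.map Term.const) ∈ Δ := by
  refine ⟨?_, fun h => ⟨cs, rfl, h⟩⟩
  rintro ⟨ds, hds, h⟩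
  obtain ⟨f, hf, hf'⟩ := hΔ.exists_canonical
  have hmap : (cs.map Term.const).map f = (ds.map Term.const).map f := by
    rw [List.map_map, List.map_map]
    exact List.map_eq_map_of_factors (fun _ _ h => hf' _ _ (hΔ.canConst_eq_iff.1 h)) hds
  rw [← hΔ.mapTerms_canonical_mem hf hf' (α := .pred P _) trivial] at h ⊢
  rwa [mapTerms, hmap]

theorem canI_rel_iff (hΔ : MCS k Δ) {c d : Cons} :
    (canI Δ : Interp Pred Cons _).rel (canConst Δ c) (canConst Δ d) ↔
      Form.rel (.const c) (.const d) ∈ Δ := by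
  refine ⟨?_, fun h => ⟨c, d, rfl, rfl, h⟩⟩
  rintro ⟨c', d', hc, hd, h⟩
  obtain ⟨f, hf, hf'⟩ := hΔ.exists_canonical
  rw [← hΔ.mapTerms_canonical_mem hf hf' (α := .rel _ _) trivial] at h ⊢
  rwa [mapTerms, hf' _ _ (hΔ.canConst_eq_iff.1 hc), hf' _ _ (hΔ.canConst_eq_iff.1 hd)]

theorem substC_mem (hΔ : MCS k Δ) {z : Var} {c : Cons} (hc : Form.eq (.var z) (.const c) ∈ Δ)
    {α : Form Pred Cons} (hα : α.isBase) : α.substC c z ∈ Δ ↔ α ∈ Δ := by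
  rw [substC_eq_mapTerms]
  refine hΔ.mapTerms_mem (fun t => ?_) hα
  rcases t with e | v
  · exact hΔ.eq_refl_mem _
  · by_cases h : v = z
    · simpa [Term.substC, h] using hc
    · simpa [Term.substC, h] using hΔ.eq_refl_mem _

theorem isBase_of_K_mem (hΔ : MCS k Δ) {z : Var} {α : Form Pred Cons} (h : Form.K z α ∈ Δ) :
    α.isBase := hΔ.isStatic h

theorem mem_of_K_mem (hΔ : MCS k Δ) {z : Var} {α : Form Pred Cons} (h : Form.K z α ∈ Δ) :
    α ∈ Δ :=
  hΔ.mem_of_prov_imp (.tAx z (hΔ.isBase_of_K_mem h))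
    (isStatic_of_isBase (hΔ.isBase_of_K_mem h)) h

theorem K_mem_of_prov (hΔ : MCS k Δ) (z : Var) {α : Form Pred Cons} (hα : α.isBase)
    (h : Prov k α) : Form.K z α ∈ Δ := by
  have sα := isStatic_of_isBase hα
  have aux : ∀ αs βs : List (Form Pred Cons), (∀ γ ∈ αs, γ.isBase) → (∀ γ ∈ βs, γ.isBase) →
      1 ≤ αs.length + βs.length → kConj z αs βs ∈ Δ → Form.K z α ∈ Δ := by
    intro αs βs hαs hβs hlen hmem
    refine hΔ.mem_of_prov_imp (.kAdd z αs βs hα hαs hβs hlen ?_) hα hmem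
    refine .of_forall_MCS (isStatic_imp.2 ⟨hΔ.isStatic hmem, sα⟩) fun Θ hΘ => ?_
    exact (hΘ.imp_mem (hΔ.isStatic hmem) sα).2 fun _ => hΘ.mem_of_prov sα h
  by_cases hK : Form.K z α.neg ∈ Δ
  · exact aux [α.neg] [] (by simpa [isBase]) (by simp) (by simp)
      (hΔ.bigAnd_mem.2 (by simpa using hK))
  · exact aux [] [α] (by simp) (by simpa) (by simp)
      (hΔ.bigAnd_mem.2 (by simpa [diaK] using (hΔ.neg_mem (φ := .K z α.neg) hα).2 hK))

theorem Kt_mem_iff (hΔ : MCS k Δ) (z : Var) {t : Term Cons} {c : Cons}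
    (h : Form.eq t (.const c) ∈ Δ) : Form.Kt z t ∈ Δ ↔ Form.K z (.eq t (.const c)) ∈ Δ := by
  have := hΔ.mem_of_prov_imp (.deRe z t c) (by simp [iffF, Form.isStatic, isBase]) h
  rwa [hΔ.iffF_mem (φ := .Kt z t) (ψ := .K z (.eq t _)) trivial trivial] at this

theorem Kt_self_mem (hΔ : MCS k Δ) (z : Var) : Form.Kt z (.var z) ∈ Δ := by
  have key : ∀ n, distForm Pred n (.var z) (.var z) ∈ Δ := by
    intro n
    induction n with
    | zero => exact hΔ.eq_refl_mem _
    | succ n ih =>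
      have hs := isStatic_or.1 (isStatic_of_isBase
        (isBase_distForm (Pred := Pred) (n + 1) (.var z) (.var z : Term Cons)))
      exact (hΔ.or_mem hs.1 hs.2).2 (.inl ih)
  exact hΔ.mem_of_prov_imp (.ksight z (.var z)) trivial (key k)

theorem substC_bigAnd_mem (hΔ : MCS k Δ) {l : List (Form Pred Cons)} {c : Cons} {z : Var}
    (h : ∀ φ ∈ l, φ.substC c z ∈ Δ) : (bigAnd l).substC c z ∈ Δ := by
  induction l with
  | nil =>
    refine (hΔ.neg_mem (φ := .neg (.eq _ _)) trivial).2 fun hn => ?_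
    exact (hΔ.neg_mem (φ := .eq _ _) trivial).1 hn (hΔ.eq_refl_mem _)
  | cons a l ih =>
    exact hΔ.and_mem.2 ⟨h a (by simp), ih fun φ hφ => h φ (by simp [hφ])⟩

theorem K_mem_iff_of_Kt (hΔ : MCS k Δ) (z : Var) (h : Form.Kt z (.var z.other) ∈ Δ)
    {α : Form Pred Cons} (hα : α.isBase) : Form.K z α ∈ Δ ↔ α ∈ Δ := by
  refine ⟨hΔ.mem_of_K_mem, fun hm => ?_⟩
  refine hΔ.mem_of_prov_imp (.structK z α.termList.toFinset hα (by simp)) hα ?_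
  refine hΔ.and_mem.2 ⟨hΔ.bigAnd_mem.2 fun φ hφ => ?_, hm⟩
  obtain ⟨t, -, rfl⟩ := List.mem_map.1 hφ
  rcases t with c | v
  · exact (hΔ.Kt_mem_iff z (hΔ.eq_refl_mem _)).2 (hΔ.K_mem_of_prov z trivial (.eqRefl _))
  · rcases v.eq_or_eq_other z with rfl | rfl
    · exact hΔ.Kt_self_mem _
    · exact h

theorem K_mem_iff_forall (hΔ : MCS k Δ) {z : Var} {T : Finset Cons}
    (hT : KzEqSet z z.other T ∈ Δ) {α : Form Pred Cons} (hα : α.isBase) :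
    Form.K z α ∈ Δ ↔ ∀ c ∈ T, α.substC c z.other ∈ Δ := by
  have sr : (bigAnd (T.toList.map fun c => α.substC c z.other)).isStatic := by
    simpa [isStatic_bigAnd] using fun c _ => isStatic_of_isBase (isBase_substC.2 hα)
  have h := hΔ.mem_of_prov_imp (.kGround z T hα) (by
    simp only [iffF, isStatic_and, isStatic_imp]
    exact ⟨⟨hα, sr⟩, sr, hα⟩) hT
  rw [hΔ.iffF_mem (φ := .K z α) hα sr, hΔ.bigAnd_mem] at h
  simpa using h

end MCS

/-- Every position `d` of the other player that `z` considers possible is realized in a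
maximal consistent set with the same constant facts, in which the other player knows
where `z` is. -/
theorem MCS.exists_variant {Δ₀ : Set (Form Pred Cons)} (hM : MCS k Δ₀) {z : Var} {T : Finset Cons}
    {c d : Cons} (hT : KzEqSet z z.other T ∈ Δ₀) (hc : Form.eq (.var z) (.const c) ∈ Δ₀)
    (hd : d ∈ T) : ∃ Δ, MCS k Δ ∧ consEq Δ Δ₀ ∧ KzEqSet z z.other T ∈ Δ ∧
      Form.K z.other (.eq (.var z) (.const c)) ∈ Δ ∧
      Form.eq (.var z.other) (.const d) ∈ Δ := by
  classical
  set G : Set (Form Pred Cons) := {α | α ∈ Δ₀ ∧ α.isBase ∧ isConsOnly α}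
  set Γ : Set (Form Pred Cons) := {KzEqSet z z.other T,
    Form.K z.other (.eq (.var z) (.const c)), Form.eq (.var z.other) (.const d)} ∪ G
  have hΓ : consistentS k Γ := by
    rintro ⟨l, hl, hp⟩
    have sl : ∀ φ ∈ l, φ.isStatic := fun φ hφ => by
      rcases hl φ hφ with (rfl | rfl | rfl) | h
      · exact hM.isStatic hT
      · trivial
      · trivial
      · exact hM.isStatic h.1
    set αs := Tᶜ.toList.map fun e => Form.neg (.eq (.var z.other) (.const e) : Form Pred Cons)
    set βs := T.toList.map fun e => (.eq (.var z.other) (.const e) : Form Pred Cons)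
    have hαs : ∀ γ ∈ αs, γ.isBase := by simp [αs, isBase]
    have hβs : ∀ γ ∈ βs, γ.isBase := by simp [βs, isBase]
    have hconj : ∀ Θ, MCS k Θ → (kConj z αs βs ∈ Θ ↔ KzEqSet z z.other T ∈ Θ) := by
      intro Θ hΘ
      rw [kConj, KzEqSet, hΘ.bigAnd_mem, hΘ.bigAnd_mem]
      simp only [αs, βs, List.map_map, List.mem_append]
      exact ⟨fun h φ hφ => h φ hφ.symm, fun h φ hφ => h φ hφ.symm⟩
    have hlen : 1 ≤ αs.length + βs.length := by
      have : 0 < T.card := Finset.card_pos.2 ⟨d, hd⟩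
      simp only [αs, βs, List.length_map, Finset.length_toList]
      omega
    have sconj := isStatic_kConj (z := z) hαs hβs
    set δ := bigAnd (l.filter (· ∈ G)) with hδ
    have bδ : δ.isBase := isBase_bigAnd fun φ hφ => by
      simp only [List.mem_filter, decide_eq_true_eq] at hφ
      exact hφ.2.2.1
    set γ : Form Pred Cons := (Form.eq (.var z) (.const c)).imp
      ((Form.eq (.var z.other) (.const d)).and δ).neg with hγ
    have bγ : γ.isBase := ⟨trivial, trivial, bδ⟩
    have hprov : Prov k ((kConj z αs βs).imp ((Form.K z.other (.eq (.var z) (.const c))).imp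
        ((Form.eq (.var z.other) (.const d)).and δ).neg)) := by
      have s₁ : (Form.K z.other (.eq (.var z) (.const c)) : Form Pred Cons).isStatic := trivial
      have s₂ : ((Form.eq (.var z.other) (.const d)).and δ).isStatic :=
        ⟨trivial, isStatic_of_isBase bδ⟩
      refine .of_forall_MCS ⟨sconj, s₁, s₂⟩ fun Θ hΘ => ?_
      rw [hΘ.imp_mem sconj (isStatic_imp.2 ⟨s₁, isStatic_neg.2 s₂⟩),
        hΘ.imp_mem s₁ (isStatic_neg.2 s₂), hΘ.neg_mem s₂, hΘ.and_mem,
        hconj Θ hΘ, hδ, hΘ.bigAnd_mem]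
      rintro hKT hK ⟨hd', hδ'⟩
      refine hΘ.falseF_notMem (hΘ.mem_of_prov_bigAnd_imp (l := l) (fun φ hφ => ?_) trivial hp)
      rcases hl φ hφ with (rfl | rfl | rfl) | h
      · exact hKT
      · exact hK
      · exact hd'
      · exact hδ' φ (by simp [hφ, h])
    have helim := Prov.kElim (k := k) (α := .eq (.var z) (.const c))
      (β := ((Form.eq (.var z.other) (.const d)).and δ).neg) z.other αs βs trivial ⟨trivial, bδ⟩
      hαs hβs hlen (by rwa [Var.other_other])
    rw [Var.other_other] at helim
    have hKγ := hM.mem_of_prov_imp (.kAdd z αs βs bγ hαs hβs hlen helim) bγ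
      ((hconj Δ₀ hM).2 hT)
    have hsub := (hM.K_mem_iff_forall hT bγ).1 hKγ d hd
    have hne : z ≠ z.other := by cases z <;> simp [Var.other]
    have e : γ.substC d z.other = (Form.eq (.var z) (.const c)).imp
        ((Form.eq (.const d) (.const d)).and (δ.substC d z.other)).neg := by
      simp [hγ, imp, Form.substC, Term.substC, hne]
    have s₃ : ((Form.eq (.const d) (.const d)).and (δ.substC d z.other)).isStatic :=
      ⟨trivial, isStatic_of_isBase (isBase_substC.2 bδ)⟩
    rw [e, hM.imp_mem (φ := .eq _ _) trivial (isStatic_neg.2 s₃), hM.neg_mem s₃, hM.and_mem] at hsub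
    refine hsub hc ⟨hM.eq_refl_mem _, hM.substC_bigAnd_mem fun φ hφ => ?_⟩
    simp only [List.mem_filter, decide_eq_true_eq] at hφ
    obtain ⟨-, hm, -, ho⟩ := hφ
    rwa [substC_eq_mapTerms, mapTerms_eq_self]
    intro t ht
    obtain ⟨e, rfl⟩ := ho t ht
    rfl
  obtain ⟨Δ, hsub, hΔ⟩ := hΓ.exists_MCS (by
    rintro φ ((rfl | rfl | rfl) | h)
    · exact hM.isStatic hT
    · trivial
    · trivial
    · exact hM.isStatic h.1)
  refine ⟨Δ, hΔ, fun α hα hα' => ⟨fun h => ?_, fun h => hsub (.inr ⟨h, hα, hα'⟩)⟩,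
    hsub (by simp [Γ]), hsub (by simp [Γ]), hsub (by simp [Γ])⟩
  by_contra hn
  refine (hΔ.neg_mem (isStatic_of_isBase hα)).1 (hsub (.inr ⟨?_, hα, hα'⟩)) h
  exact (hM.neg_mem (isStatic_of_isBase hα)).2 hn

/-! ### Truth of base formulas in the canonical model -/

variable {Δ₀ Δ Δ' : Set (Form Pred Cons)}

theorem MCS.canAsg_eq [Nonempty Cons] (hM : MCS k Δ₀) (hΔ : MCS k Δ) (he : consEq Δ Δ₀)
    {z : Var} {c : Cons} (h : Form.eq (.var z) (.const c) ∈ Δ) : canAsg Δ₀ Δ z = canConst Δ₀ c := by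
  have hex : ∃ c : Cons, Form.eq (Term.var z) (Term.const c) ∈ Δ := ⟨c, h⟩
  rw [canAsg, dif_pos hex, hM.canConst_eq_iff,
    ← he (.eq _ _) trivial (by simp [isConsOnly, termList])]
  exact hΔ.eq_trans_mem (hΔ.eq_symm_mem hex.choose_spec) h

theorem MCS.sat_iff_of_isBase [Nonempty Cons] (hM : MCS k Δ₀) (hΔ : MCS k Δ) (he : consEq Δ Δ₀)
    (Sit : Set (Assign (CanD Δ₀))) (sim : SimRel (CanD Δ₀)) {α : Form Pred Cons}
    (hα : α.isBase) : Sat k (canI Δ₀) Sit sim (canAsg Δ₀ Δ) α ↔ α ∈ Δ := by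
  choose r hr using hΔ.exists_eq_const_mem
  have hval : ∀ t : Term Cons, t.val (canI Δ₀) (canAsg Δ₀ Δ) = canConst Δ₀ (r t) := by
    rintro (c | v)
    · exact hM.canConst_eq_iff.2 ((he (.eq _ _) trivial (by simp [isConsOnly, termList])).1 (hr _))
    · exact hM.canAsg_eq hΔ he (hr _)
  have hatom : ∀ β : Form Pred Cons, β.isBase →
      (β ∈ Δ ↔ β.mapTerms (fun t => .const (r t)) ∈ Δ₀) := by
    intro β hβ
    rw [← hΔ.mapTerms_mem hr hβ, he _ (isBase_mapTerms.2 hβ)]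
    intro t ht
    rw [termList_mapTerms, List.mem_map] at ht
    obtain ⟨s, -, rfl⟩ := ht
    exact ⟨_, rfl⟩
  induction α with
  | pred P args =>
    rw [Sat, hatom (.pred _ _) trivial, mapTerms, List.map_congr_left fun t _ => hval t]
    simpa only [List.map_map, Function.comp_def] using
      hM.canI_pred_iff (P := P) (cs := args.map r)
  | rel t₁ t₂ => rw [Sat, hatom (.rel _ _) trivial, hval, hval, hM.canI_rel_iff, mapTerms]
  | eq t₁ t₂ => rw [Sat, hatom (.eq _ _) trivial, hval, hval, hM.canConst_eq_iff, mapTerms]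
  | neg φ ih =>
    rw [Sat, hΔ.neg_mem (φ := φ) (isStatic_of_isBase hα)]
    exact not_congr (ih hα)
  | and φ ψ ih₁ ih₂ =>
    rw [Sat, hΔ.and_mem]
    exact and_congr (ih₁ hα.1) (ih₂ hα.2)
  | Kt | K | box => exact hα.elim

/-! ### Situations of the canonical model -/

/-- `CanSit`, with the data of the two players indexed by `Var`. -/
theorem mem_CanSit_iff {T : Var → Finset Cons} {c : Var → Cons} :
    Δ ∈ CanSit k Δ₀ (T .x) (T .y) (c .x) (c .y) ↔ Δ = Δ₀ ∨ ∃ z : Var,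
      MCS k Δ ∧ consEq Δ Δ₀ ∧ KzEqSet z z.other (T z) ∈ Δ ∧
      Form.K z.other (.eq (.var z) (.const (c z))) ∈ Δ ∧
      ∃ d ∈ T z, Form.eq (.var z.other) (.const d) ∈ Δ ∧
        Form.neg (.eq (.const d) (.const (c z.other))) ∈ Δ := by
  simp only [CanSit, Set.mem_union, Set.mem_singleton_iff, Set.mem_ofPred_eq, or_assoc]
  refine or_congr_right ⟨?_, ?_⟩
  · rintro (h | h)
    exacts [⟨.x, h⟩, ⟨.y, h⟩]
  · rintro ⟨z, h⟩
    cases z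
    exacts [.inl h, .inr h]

theorem Kset_eq_of_KzEqSet_mem (hΔ : MCS k Δ) (hΔ' : MCS k Δ') (he : consEq Δ Δ') {z : Var}
    {T : Finset Cons} {c : Cons} (hT : KzEqSet z z.other T ∈ Δ) (hT' : KzEqSet z z.other T ∈ Δ')
    (hc : Form.eq (.var z) (.const c) ∈ Δ) (hc' : Form.eq (.var z) (.const c) ∈ Δ') :
    Kset z Δ = Kset z Δ' := by
  have key : ∀ α : Form Pred Cons, α.isBase → (Form.K z α ∈ Δ ↔ Form.K z α ∈ Δ') := by
    intro α hα
    rw [hΔ.K_mem_iff_forall hT hα, hΔ'.K_mem_iff_forall hT' hα]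
    refine forall₂_congr fun d _ => ?_
    have hb := isBase_substC (c := d) (z := z.other).2 hα
    rw [← hΔ.substC_mem hc hb, ← hΔ'.substC_mem hc' hb]
    exact he _ (isBase_substC.2 hb) (isConsOnly_substC_substC_other _ _ _ _)
  ext α
  exact ⟨fun h => (key α (hΔ.isBase_of_K_mem h)).1 h, fun h => (key α (hΔ'.isBase_of_K_mem h)).2 h⟩

variable {T : Var → Finset Cons} {c : Var → Cons}

theorem MCS.of_mem_CanSit (hM : MCS k Δ₀)
    (hΔ : Δ ∈ CanSit k Δ₀ (T .x) (T .y) (c .x) (c .y)) : MCS k Δ ∧ consEq Δ Δ₀ := by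
  rcases mem_CanSit_iff.1 hΔ with rfl | ⟨z, h, he, -⟩
  · exact ⟨hM, fun _ _ _ => Iff.rfl⟩
  · exact ⟨h, he⟩

theorem CanSit_dichotomy (hT : ∀ z, KzEqSet z z.other (T z) ∈ Δ₀)
    (hc : ∀ z, Form.eq (.var z) (.const (c z)) ∈ Δ₀)
    (hΔ : Δ ∈ CanSit k Δ₀ (T .x) (T .y) (c .x) (c .y)) (z : Var) :
    (Form.eq (.var z) (.const (c z)) ∈ Δ ∧ KzEqSet z z.other (T z) ∈ Δ) ∨
      (Form.eq (.var z) (.const (c z)) ∉ Δ ∧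
        ∀ α : Form Pred Cons, α.isBase → (Form.K z α ∈ Δ ↔ α ∈ Δ)) := by
  rcases mem_CanSit_iff.1 hΔ with rfl | ⟨w, h, he, hTw, hK, d, hd, hwd, hdc⟩
  · exact .inl ⟨hc z, hT z⟩
  · have hw := h.mem_of_K_mem hK
    rcases z.eq_or_eq_other w with rfl | rfl
    · exact .inl ⟨hw, hTw⟩
    · refine .inr ⟨fun hn => (h.neg_mem (φ := .eq _ _) trivial).1 hdc
        (h.eq_trans_mem (h.eq_symm_mem hwd) hn),
        fun α hα => h.K_mem_iff_of_Kt _ ?_ hα⟩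
      rw [Var.other_other]
      exact (h.Kt_mem_iff _ hw).2 hK

theorem Kset_eq_of_canAsg_eq [Nonempty Cons] (hM : MCS k Δ₀)
    (hT : ∀ z, KzEqSet z z.other (T z) ∈ Δ₀)
    (hc : ∀ z, Form.eq (.var z) (.const (c z)) ∈ Δ₀)
    (hΔ : Δ ∈ CanSit k Δ₀ (T .x) (T .y) (c .x) (c .y))
    (hΔ' : Δ' ∈ CanSit k Δ₀ (T .x) (T .y) (c .x) (c .y))
    (h : canAsg Δ₀ Δ = canAsg Δ₀ Δ') (z : Var) : Kset z Δ = Kset z Δ' := by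
  obtain ⟨m, e⟩ := hM.of_mem_CanSit hΔ
  obtain ⟨m', e'⟩ := hM.of_mem_CanSit hΔ'
  have hb : ∀ α : Form Pred Cons, α.isBase → (α ∈ Δ ↔ α ∈ Δ') := fun α hα => by
    rw [← hM.sat_iff_of_isBase m e ∅ (fun _ _ _ => False) hα, h,
      hM.sat_iff_of_isBase m' e' ∅ (fun _ _ _ => False) hα]
  rcases CanSit_dichotomy hT hc hΔ z with ⟨h₁, h₂⟩ | ⟨h₁, h₂⟩ <;>
    rcases CanSit_dichotomy hT hc hΔ' z with ⟨h₁', h₂'⟩ | ⟨h₁', h₂'⟩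
  · exact Kset_eq_of_KzEqSet_mem m m' (fun α hα _ => hb α hα) h₂ h₂' h₁ h₁'
  · exact (h₁' ((hb (.eq _ _) trivial).1 h₁)).elim
  · exact (h₁ ((hb (.eq _ _) trivial).2 h₁')).elim
  · ext α
    refine ⟨fun h => ?_, fun h => ?_⟩
    · have hα := m.isBase_of_K_mem h
      exact (h₂' α hα).2 ((hb α hα).1 ((h₂ α hα).1 h))
    · have hα := m'.isBase_of_K_mem h
      exact (h₂ α hα).2 ((hb α hα).2 ((h₂' α hα).1 h))

theorem exists_Kset_eq_notMem (hM : MCS k Δ₀)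
    (hT : ∀ z, KzEqSet z z.other (T z) ∈ Δ₀)
    (hc : ∀ z, Form.eq (.var z) (.const (c z)) ∈ Δ₀)
    (hΔ : Δ ∈ CanSit k Δ₀ (T .x) (T .y) (c .x) (c .y)) {z : Var}
    {α : Form Pred Cons} (hα : α.isBase) (hK : Form.K z α ∉ Δ) :
    ∃ Δ' ∈ CanSit k Δ₀ (T .x) (T .y) (c .x) (c .y), Kset z Δ' = Kset z Δ ∧ α ∉ Δ' := by
  obtain ⟨m, e⟩ := hM.of_mem_CanSit hΔ
  rcases CanSit_dichotomy hT hc hΔ z with ⟨h₁, h₂⟩ | ⟨-, h₂⟩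
  · rw [m.K_mem_iff_forall h₂ hα] at hK
    push Not at hK
    obtain ⟨d, hd, hn⟩ := hK
    have key : ∀ Δ' : Set (Form Pred Cons), MCS k Δ' → consEq Δ' Δ₀ →
        Form.eq (.var z) (.const (c z)) ∈ Δ' → KzEqSet z z.other (T z) ∈ Δ' →
        Form.eq (.var z.other) (.const d) ∈ Δ' → Kset z Δ' = Kset z Δ ∧ α ∉ Δ' := by
      intro Δ' m' e' h₁' h₂' hd'
      have he : consEq Δ' Δ := fun β b o => (e' β b o).trans (e β b o).symm
      refine ⟨Kset_eq_of_KzEqSet_mem m' m he h₂' h₂ h₁' h₁, fun hmem => hn ?_⟩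
      have hb := isBase_substC (c := d) (z := z.other).2 hα
      rw [← m.substC_mem h₁ hb,
        ← he _ (isBase_substC.2 hb) (isConsOnly_substC_substC_other _ _ _ _),
        m'.substC_mem h₁' hb, m'.substC_mem hd' hα]
      exact hmem
    by_cases hdc : Form.eq (.const d) (.const (c z.other)) ∈ Δ₀
    · exact ⟨Δ₀, mem_CanSit_iff.2 (.inl rfl), key Δ₀ hM (fun _ _ _ => Iff.rfl) (hc z) (hT z)
        (hM.eq_trans_mem (hc _) (hM.eq_symm_mem hdc))⟩
    · obtain ⟨Δ', m', e', hT', hK', hd'⟩ := hM.exists_variant (hT z) (hc z) hd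
      refine ⟨Δ', mem_CanSit_iff.2 (.inr ⟨z, m', e', hT', hK', d, hd, hd', ?_⟩),
        key Δ' m' e' (m'.mem_of_K_mem hK') hT' hd'⟩
      rwa [m'.neg_mem (φ := .eq _ _) trivial, e' (.eq _ _) trivial (by simp [isConsOnly, termList])]
  · exact ⟨Δ, hΔ, rfl, fun h => hK ((h₂ α hα).2 h)⟩

theorem sat_K_iff [Nonempty Cons] (hM : MCS k Δ₀)
    (hT : ∀ z, KzEqSet z z.other (T z) ∈ Δ₀)
    (hc : ∀ z, Form.eq (.var z) (.const (c z)) ∈ Δ₀)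
    (hΔ : Δ ∈ CanSit k Δ₀ (T .x) (T .y) (c .x) (c .y)) {z : Var}
    {α : Form Pred Cons} (hα : α.isBase) :
    Sat k (canI Δ₀) (CanSitA k Δ₀ (T .x) (T .y) (c .x) (c .y))
      (canSim Δ₀ (CanSit k Δ₀ (T .x) (T .y) (c .x) (c .y))) (canAsg Δ₀ Δ) (.K z α) ↔
    Form.K z α ∈ Δ := by
  rw [Sat]
  refine ⟨fun h => ?_, ?_⟩
  · by_contra hK
    obtain ⟨Δ', hΔ', hKset, hn⟩ := exists_Kset_eq_notMem hM hT hc hΔ hα hK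
    obtain ⟨m', e'⟩ := hM.of_mem_CanSit hΔ'
    exact hn ((hM.sat_iff_of_isBase m' e' _ _ hα).1
      (h _ ⟨Δ', hΔ', rfl⟩ ⟨Δ', hΔ', Δ, hΔ, rfl, rfl, hKset⟩))
  · rintro h _ - ⟨Δ₁, hΔ₁, Δ₂, hΔ₂, rfl, heq, hKset⟩
    obtain ⟨m₁, e₁⟩ := hM.of_mem_CanSit hΔ₁
    rw [hM.sat_iff_of_isBase m₁ e₁ _ _ hα]
    refine m₁.mem_of_K_mem (z := z) ?_
    change α ∈ Kset z Δ₁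
    rwa [hKset, ← Kset_eq_of_canAsg_eq hM hT hc hΔ hΔ₂ heq z]

theorem sat_iff_mem [Nonempty Cons] (hM : MCS k Δ₀)
    (hT : ∀ z, KzEqSet z z.other (T z) ∈ Δ₀)
    (hc : ∀ z, Form.eq (.var z) (.const (c z)) ∈ Δ₀)
    {φ : Form Pred Cons} (hφ : φ.isStatic)
    (hΔ : Δ ∈ CanSit k Δ₀ (T .x) (T .y) (c .x) (c .y)) :
    Sat k (canI Δ₀) (CanSitA k Δ₀ (T .x) (T .y) (c .x) (c .y))
      (canSim Δ₀ (CanSit k Δ₀ (T .x) (T .y) (c .x) (c .y))) (canAsg Δ₀ Δ) φ ↔ φ ∈ Δ := by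
  obtain ⟨m, e⟩ := hM.of_mem_CanSit hΔ
  induction φ with
  | pred | rel | eq => exact hM.sat_iff_of_isBase m e _ _ trivial
  | neg φ ih => rw [Sat, ih hφ, m.neg_mem (isStatic_neg.1 hφ)]
  | and φ ψ ih₁ ih₂ => rw [Sat, ih₁ hφ.1, ih₂ hφ.2, m.and_mem]
  | K z α => exact sat_K_iff hM hT hc hΔ hφ
  | Kt z t =>
    obtain ⟨d, hd⟩ := m.exists_eq_const_mem t
    rw [m.Kt_mem_iff z hd, ← sat_K_iff hM hT hc hΔ (α := .eq _ _) trivial, Sat, Sat]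
    have hval : t.val (canI Δ₀) (canAsg Δ₀ Δ) = canConst Δ₀ d :=
      (hM.sat_iff_of_isBase m e ∅ (fun _ _ _ => False) (α := .eq t (.const d)) trivial).2 hd
    rw [hval]
    exact forall₃_congr fun _ _ _ => eq_comm
  | box => exact hφ.elim

end

/-- **Truth Lemma.** In the canonical model, an `L⁻`-formula is
true at (the assignment induced by) `Δ` iff it belongs to `Δ`. -/
theorem truth_lemma {Pred Cons : Type} [Fintype Cons] [DecidableEq Cons]
    [Nonempty Cons] (k : ℕ) (Δ₀ : Set (Form Pred Cons)) (Ty Tx : Finset Cons)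
    (cx cy : Cons) (hM : MCS k Δ₀)
    (h₁ : KzEqSet Var.x Var.y Ty ∈ Δ₀) (h₂ : KzEqSet Var.y Var.x Tx ∈ Δ₀)
    (h₃ : Form.eq (Term.var .x) (Term.const cx) ∈ Δ₀)
    (h₄ : Form.eq (Term.var .y) (Term.const cy) ∈ Δ₀) :
    ∀ φ : Form Pred Cons, φ.isStatic → ∀ Δ ∈ CanSit k Δ₀ Ty Tx cx cy,
      (Sat k (canI Δ₀) (CanSitA k Δ₀ Ty Tx cx cy)
          (canSim Δ₀ (CanSit k Δ₀ Ty Tx cx cy)) (canAsg Δ₀ Δ) φ ↔ φ ∈ Δ) := by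
  intro φ hφ Δ hΔ
  exact sat_iff_mem (T := fun z => match z with | .x => Ty | .y => Tx)
    (c := fun z => match z with | .x => cx | .y => cy) hM
    (fun z => by cases z; exacts [h₁, h₂]) (fun z => by cases z; exacts [h₃, h₄]) hφ hΔ
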